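/- Let X be a σ-compact Polish space and let P = (X, d, x̄) be any presentation of X. Then there exist countable ordinals α_P and β_P such that for every countable closed subset F ⊆ X one has φ_P(F) ≤ (ω·|F|_CB + α_P)·|X|_{K_σ} + β_P (ordinal arithmetic). -/

import Mathlib

open Set Filter Topology

/-- A presentation `(X, d, x̄)` of a Polish space `X`: a complete metric `d`
compatible with the topology of `X`, together with a dense sequence `x̄`. -/
structure Presentation (X : Type) [TopologicalSpace X] where
  dist : X → X → ℝ
  seq : ℕ → X
  dist_self : ∀ x, dist x x = 0
  eq_of_dist_eq_zero : ∀ x y, dist x y = 0 → x = y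
  dist_comm : ∀ x y, dist x y = dist y x
  dist_triangle : ∀ x y z, dist x z ≤ dist x y + dist y z
  /-- `d` is compatible with the topology of `X`. -/
  isOpen_iff : ∀ s : Set X, IsOpen s ↔ ∀ x ∈ s, ∃ ε > 0, ∀ y, dist y x < ε → y ∈ s
  /-- `d` is complete. -/
  complete : ∀ u : ℕ → X, (∀ ε > 0, ∃ N, ∀ m ≥ N, ∀ n ≥ N, dist (u m) (u n) < ε) →
      ∃ x, ∀ ε > 0, ∃ N, ∀ n ≥ N, dist (u n) x < ε
  /-- the sequence `x̄` is dense. -/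
  dense : ∀ x, ∀ ε > 0, ∃ i, dist x (seq i) < ε

namespace Presentation

variable {X : Type} [TopologicalSpace X] (P : Presentation X)

/-- The open ball `B_P(n)`. -/
def ball (n : ℕ × ℕ) : Set X := {x | P.dist x (P.seq n.1) < (1/2 : ℝ) ^ (n.2 + 1)}

/-- The closed ball `B̄_P(n)`. -/
def cball (n : ℕ × ℕ) : Set X := {x | P.dist x (P.seq n.1) ≤ (1/2 : ℝ) ^ (n.2 + 1)}

/-- The relation `n ≺_P m`. -/
def prec (n m : ℕ × ℕ) : Prop := n.2 < m.2 ∧ P.cball m ⊆ P.ball n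

/-- The relation `n ⋏_P m`. -/
def apart (n m : ℕ × ℕ) : Prop := P.cball n ∩ P.cball m = ∅

/-- The code `A_F^P` of a closed set `F ⊆ X`. -/
def code (F : Set X) : Set (ℕ × ℕ) := {n | (P.ball n ∩ F).Nonempty}

/-- The derivative `D_P` on subsets of `ω × ω`. -/
def deriv (A : Set (ℕ × ℕ)) : Set (ℕ × ℕ) :=
  {n ∈ A | ∃ u ∈ A, ∃ v ∈ A, P.prec n u ∧ P.prec n v ∧ P.apart u v}

/-- The transfinite iterates `D_P^α(A)`. -/
noncomputable def derivIter (A : Set (ℕ × ℕ)) (α : Ordinal.{0}) : Set (ℕ × ℕ) :=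
  Ordinal.limitRecOn α A (fun _ ih => P.deriv ih)
    (fun o _ ih => ⋂ (β : {β : Ordinal.{0} // β < o}), ih β.1 β.2)

/-- The rank `|A|_P`: the least ordinal `α` with `D_P^α(A) = D_P^{α+1}(A)`. -/
noncomputable def rankA (A : Set (ℕ × ℕ)) : Ordinal.{0} :=
  sInf {α | P.derivIter A (α + 1) = P.derivIter A α}

/-- The rank `φ_P(F) = |A_F^P|_P` of a (countable closed) subset `F ⊆ X`. -/
noncomputable def phi (F : Set X) : Ordinal.{0} := P.rankA (P.code F)

/-- `A ⊆ ω × ω` is `P`-closed. -/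
def PClosed (A : Set (ℕ × ℕ)) : Prop := ∀ n ∈ A, ∀ m, P.prec m n → m ∈ A

/-- `A ⊆ ω × ω` is `P`-pruned. -/
def PPruned (A : Set (ℕ × ℕ)) : Prop := ∀ n ∈ A, ∃ m ∈ A, P.prec n m

/-- `A ⊆ ω × ω` is `P`-perfect. -/
def PPerfect (A : Set (ℕ × ℕ)) : Prop :=
  ∀ n ∈ A, ∃ u ∈ A, ∃ v ∈ A, P.prec n u ∧ P.prec n v ∧ P.apart u v

/-- The set `[A]_P` of `P`-compatible sequences lying in `A`. -/
def body (A : Set (ℕ × ℕ)) : Set (ℕ → ℕ × ℕ) :=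
  {f | (∀ i, P.prec (f i) (f (i + 1))) ∧ ∀ i, f i ∈ A}

/-- The set `F_A^P = π_P([A]_P)`: the points obtained as the unique point of
`⋂_i B_P(n_i)` for a `P`-compatible sequence `(n_i)` in `A`. -/
def limitSet (A : Set (ℕ × ℕ)) : Set X :=
  {x | ∃ f ∈ P.body A, ∀ i, x ∈ P.ball (f i)}

end Presentation

section CB

variable {X : Type} [TopologicalSpace X]

/-- The Cantor–Bendixson derivative: the set of limit points of `F` in `F`. -/
def cbDeriv (F : Set X) : Set X := {x ∈ F | AccPt x (𝓟 F)}

/-- The iterated Cantor–Bendixson derivatives `F^α`. -/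
noncomputable def cbIter (F : Set X) (α : Ordinal.{0}) : Set X :=
  Ordinal.limitRecOn α F (fun _ ih => cbDeriv ih)
    (fun o _ ih => ⋂ (β : {β : Ordinal.{0} // β < o}), ih β.1 β.2)

/-- The Cantor–Bendixson rank `|F|_CB`. -/
noncomputable def cbRank (F : Set X) : Ordinal.{0} :=
  sInf {α | cbIter F (α + 1) = cbIter F α}

/-- The `K_σ`-derivative of a subset `A ⊆ X`: the points of `A` having no open
neighborhood in the subspace `A` whose closure in `A` is compact. -/
def kDeriv (A : Set X) : Set X :=
  {x ∈ A | ∀ U : Set X, IsOpen U → x ∈ U → ¬ IsCompact (A ∩ closure (U ∩ A))}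

/-- The iterated `K_σ`-derivatives `X_α` of the space `X`. -/
noncomputable def kIter (X : Type) [TopologicalSpace X] (α : Ordinal.{0}) : Set X :=
  Ordinal.limitRecOn α Set.univ (fun _ ih => kDeriv ih)
    (fun o _ ih => ⋂ (β : {β : Ordinal.{0} // β < o}), ih β.1 β.2)

/-- The `K_σ`-rank `|X|_{K_σ}`. -/
noncomputable def kRank (X : Type) [TopologicalSpace X] : Ordinal.{0} :=
  sInf {α | kIter X (α + 1) = kIter X α}

end CB

section Iteration

variable {α : Type}

/-- A transfinite sequence that is decreasing at successors and given by intersections at limits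
is decreasing. -/
theorem antitone_of_iInter_limit {g : Ordinal.{0} → Set α} (hs : ∀ o, g (o + 1) ⊆ g o)
    (hl : ∀ o, Order.IsSuccLimit o → g o = ⋂ β : {β : Ordinal.{0} // β < o}, g β.1) :
    Antitone g := by
  suffices H : ∀ b a, a ≤ b → g b ⊆ g a from fun a b h => H b a h
  intro b
  induction b using Ordinal.limitRecOn with
  | zero => intro a h; rw [nonpos_iff_eq_zero.1 h]
  | add_one o ih =>
    intro a h
    rcases h.eq_or_lt with rfl | h
    · exact subset_rfl
    · exact (hs o).trans (ih a (Order.lt_add_one_iff.1 h))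
  | limit o ho _ =>
    intro a h
    rcases h.eq_or_lt with rfl | h
    · exact subset_rfl
    · rw [hl o ho]
      exact iInter_subset _ (⟨a, h⟩ : {β : Ordinal.{0} // β < o})

/-- A decreasing transfinite sequence of subsets of a set stabilizes. -/
theorem exists_add_one_eq_of_antitone {g : Ordinal.{0} → Set α} (hg : Antitone g) :
    ∃ o, g (o + 1) = g o := by
  by_contra! H
  refine not_injective_of_ordinal g fun a b hab => ?_
  by_contra hne
  wlog hlt : a < b generalizing a b
  · exact this b a hab.symm (Ne.symm hne) (lt_of_le_of_ne (not_lt.1 hlt) (Ne.symm hne))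
  exact H a (subset_antisymm (hg (Order.le_succ a))
    (hab.le.trans (hg (Order.add_one_le_of_lt hlt))))

end Iteration

section Derivatives

variable {X : Type} [TopologicalSpace X]

theorem cbIter_zero (F : Set X) : cbIter F 0 = F := by simp [cbIter]

theorem cbIter_add_one (F : Set X) (o : Ordinal.{0}) :
    cbIter F (o + 1) = cbDeriv (cbIter F o) := by simp [cbIter]

theorem cbIter_limit (F : Set X) {o : Ordinal.{0}} (ho : Order.IsSuccLimit o) :
    cbIter F o = ⋂ β : {β : Ordinal.{0} // β < o}, cbIter F β.1 := by
  rw [cbIter, Ordinal.limitRecOn_limit _ _ _ _ ho]; rfl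

theorem cbIter_antitone (F : Set X) : Antitone (cbIter F) :=
  antitone_of_iInter_limit (fun o => by rw [cbIter_add_one]; exact sep_subset _ _)
    fun _ => cbIter_limit F

theorem isClosed_cbDeriv [T1Space X] {F : Set X} (hF : IsClosed F) : IsClosed (cbDeriv F) :=
  hF.inter (isClosed_derivedSet F)

theorem isClosed_cbIter [T1Space X] {F : Set X} (hF : IsClosed F) (o : Ordinal.{0}) :
    IsClosed (cbIter F o) := by
  induction o using Ordinal.limitRecOn with
  | zero => rwa [cbIter_zero]
  | add_one o ih => rw [cbIter_add_one]; exact isClosed_cbDeriv ih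
  | limit o ho ih => rw [cbIter_limit F ho]; exact isClosed_iInter fun β => ih β.1 β.2

/-- The Cantor–Bendixson derivatives of a countable closed set end with the empty set. -/
theorem cbIter_cbRank_eq_empty [PolishSpace X] {F : Set X} (hF : IsClosed F)
    (hc : F.Countable) : cbIter F (cbRank F) = ∅ := by
  have h : cbIter F (cbRank F + 1) = cbIter F (cbRank F) :=
    csInf_mem (exists_add_one_eq_of_antitone (cbIter_antitone F))
  rw [cbIter_add_one] at h
  have hperf : Perfect (cbIter F (cbRank F)) :=
    ⟨isClosed_cbIter hF _, fun x hx => (h.symm ▸ hx : x ∈ cbDeriv _).2⟩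
  by_contra hne
  let := TopologicalSpace.upgradeIsCompletelyMetrizable X
  obtain ⟨f, hf, -, hinj⟩ := hperf.exists_nat_bool_injection (nonempty_iff_ne_empty.2 hne)
  have hsub : range f ⊆ F :=
    hf.trans ((cbIter_antitone F (zero_le (a := cbRank F))).trans (cbIter_zero F).le)
  have : Countable (ℕ → Bool) := by
    have := (hc.mono hsub).to_subtype
    exact (Equiv.ofInjective f hinj).countable_iff.2 this
  have h2 := Cardinal.mk_le_aleph0_iff.2 this
  simp only [Cardinal.mk_pi, Cardinal.mk_bool, Cardinal.prod_const, Cardinal.lift_id,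
    Cardinal.mk_nat, Cardinal.two_power_aleph0] at h2
  exact h2.not_gt Cardinal.aleph0_lt_continuum

theorem kIter_zero : kIter X 0 = univ := by simp [kIter]

theorem kIter_add_one (o : Ordinal.{0}) : kIter X (o + 1) = kDeriv (kIter X o) := by
  simp [kIter]

theorem kIter_limit {o : Ordinal.{0}} (ho : Order.IsSuccLimit o) :
    kIter X o = ⋂ β : {β : Ordinal.{0} // β < o}, kIter X β.1 := by
  rw [kIter, Ordinal.limitRecOn_limit _ _ _ _ ho]; rfl

theorem kIter_antitone : Antitone (kIter X) :=
  antitone_of_iInter_limit (fun o => by rw [kIter_add_one]; exact sep_subset _ _)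
    fun _ => kIter_limit

theorem isClosed_kDeriv {A : Set X} (hA : IsClosed A) : IsClosed (kDeriv A) := by
  have : kDeriv A = A ∩ ⋂ U : {U : Set X // IsOpen U ∧ IsCompact (A ∩ closure (U ∩ A))},
      (U : Set X)ᶜ := by
    ext x
    simp only [kDeriv, mem_ofPred_eq, mem_inter_iff, mem_iInter, Subtype.forall,
      mem_compl_iff]
    grind
  rw [this]
  exact hA.inter (isClosed_iInter fun U => U.2.1.isClosed_compl)

theorem isClosed_kIter (o : Ordinal.{0}) : IsClosed (kIter X o) := by
  induction o using Ordinal.limitRecOn with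
  | zero => rw [kIter_zero]; exact isClosed_univ
  | add_one o ih => rw [kIter_add_one]; exact isClosed_kDeriv ih
  | limit o ho ih => rw [kIter_limit ho]; exact isClosed_iInter fun β => ih β.1 β.2

/-- By the Baire category theorem, a nonempty closed subset of a σ-compact Polish space has a
point of local compactness. -/
theorem eq_empty_of_kDeriv_eq [PolishSpace X] [SigmaCompactSpace X] {A : Set X}
    (hA : IsClosed A) (h : kDeriv A = A) : A = ∅ := by
  by_contra hne
  have : Nonempty A := (nonempty_iff_ne_empty.2 hne).to_subtype
  have : PolishSpace A := hA.polishSpace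
  have : BaireSpace A := by
    let := TopologicalSpace.upgradeIsCompletelyMetrizable A
    infer_instance
  have hK (i : ℕ) : IsClosed (compactCovering X i) := (isCompact_compactCovering X i).isClosed
  obtain ⟨i, x, hx⟩ := nonempty_interior_of_iUnion_of_closed
    (f := fun i => ((↑) : A → X) ⁻¹' compactCovering X i)
    (fun i => (hK i).preimage continuous_subtype_val)
    (by rw [← preimage_iUnion, iUnion_compactCovering, preimage_univ])
  obtain ⟨V, hV, hVo, hxV⟩ := mem_interior.1 hx
  obtain ⟨U, hU, rfl⟩ := isOpen_induced_iff.1 hVo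
  have hmem : (x : X) ∈ kDeriv A := h.symm ▸ x.2
  refine hmem.2 U hU hxV (((isCompact_compactCovering X i).of_isClosed_subset
    (hA.inter isClosed_closure)) (inter_subset_right.trans (closure_minimal ?_ (hK i))))
  rintro y ⟨hyU, hyA⟩
  exact hV (show (⟨y, hyA⟩ : A) ∈ _ from hyU)

theorem kIter_kRank_eq_empty [PolishSpace X] [SigmaCompactSpace X] :
    kIter X (kRank X) = ∅ := by
  have h : kIter X (kRank X + 1) = kIter X (kRank X) :=
    csInf_mem (exists_add_one_eq_of_antitone kIter_antitone)
  rw [kIter_add_one] at h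
  exact eq_empty_of_kDeriv_eq (isClosed_kIter _) h

/-- A point lying outside some `K_σ`-iterate lies in a last one, where it has a neighborhood
whose traces are relatively compact. -/
theorem exists_isCompact_of_notMem_kIter {x : X} {o : Ordinal.{0}} (hx : x ∉ kIter X o) :
    ∃ μ < o, x ∈ kIter X μ ∧ ∃ U : Set X, IsOpen U ∧ x ∈ U ∧
      IsCompact (kIter X μ ∩ closure (U ∩ kIter X μ)) := by
  induction o using Ordinal.limitRecOn with
  | zero => simp [kIter_zero] at hx
  | add_one o ih =>
    by_cases hxo : x ∈ kIter X o
    · refine ⟨o, Order.lt_add_one_iff.2 le_rfl, hxo, ?_⟩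
      rw [kIter_add_one] at hx
      by_contra! H
      exact hx ⟨hxo, H⟩
    · obtain ⟨μ, hμ, H⟩ := ih hxo
      exact ⟨μ, hμ.trans (Order.lt_add_one_iff.2 le_rfl), H⟩
  | limit o ho ih =>
    simp only [kIter_limit ho, mem_iInter, not_forall] at hx
    obtain ⟨β, hβ⟩ := hx
    obtain ⟨μ, hμ, H⟩ := ih β.1 β.2 hβ
    exact ⟨μ, hμ.trans β.2, H⟩

end Derivatives

namespace Presentation

variable {X : Type} [TopologicalSpace X] (P : Presentation X)

/-- The metric space structure underlying a presentation. -/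
abbrev metricSpace : MetricSpace X :=
  MetricSpace.ofDistTopology P.dist P.dist_self P.dist_comm P.dist_triangle
    (fun s => by simp only [P.isOpen_iff s, P.dist_comm]) P.eq_of_dist_eq_zero

theorem isClosed_cball (n : ℕ × ℕ) : IsClosed (P.cball n) := by
  let := P.metricSpace
  exact Metric.isClosed_closedBall (x := P.seq n.1) (ε := (1/2 : ℝ) ^ (n.2 + 1))

theorem ball_subset_cball (n : ℕ × ℕ) : P.ball n ⊆ P.cball n := fun x hx =>
  le_of_lt (show P.dist x (P.seq n.1) < (1/2 : ℝ) ^ (n.2 + 1) from hx)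

theorem seq_mem_ball (n : ℕ × ℕ) : P.seq n.1 ∈ P.ball n := by
  simp [ball, P.dist_self]

theorem dist_le_of_mem_cball {n : ℕ × ℕ} {x y : X} (hx : x ∈ P.cball n) (hy : y ∈ P.cball n) :
    P.dist x y ≤ (1/2 : ℝ) ^ n.2 := by
  have h := P.dist_triangle x (P.seq n.1) y
  have hx' : P.dist x (P.seq n.1) ≤ (1/2 : ℝ) ^ (n.2 + 1) := hx
  have hy' : P.dist y (P.seq n.1) ≤ (1/2 : ℝ) ^ (n.2 + 1) := hy
  rw [P.dist_comm y] at hy'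
  rw [pow_succ] at hx' hy'
  linarith

theorem dist_lt_of_mem_cball {ε : ℝ} (hε : 0 < ε) :
    ∃ N : ℕ, ∀ n : ℕ × ℕ, N ≤ n.2 → ∀ x ∈ P.cball n, ∀ y ∈ P.cball n, P.dist x y < ε := by
  obtain ⟨N, hN⟩ := exists_pow_lt_of_lt_one hε (show (1/2 : ℝ) < 1 by norm_num)
  exact ⟨N, fun n hn x hx y hy => (P.dist_le_of_mem_cball hx hy).trans_lt
    ((pow_le_pow_of_le_one (by norm_num) (by norm_num) hn).trans_lt hN)⟩

/-- Balls with small radius around a point of an open set lie in the open set. -/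
theorem exists_cball_subset {x : X} {U : Set X} (hU : IsOpen U) (hx : x ∈ U) :
    ∃ N : ℕ, ∀ n : ℕ × ℕ, N ≤ n.2 → x ∈ P.cball n → P.cball n ⊆ U := by
  obtain ⟨ε, hε, h⟩ := (P.isOpen_iff U).1 hU x hx
  obtain ⟨N, hN⟩ := P.dist_lt_of_mem_cball hε
  exact ⟨N, fun n hn hxn y hy => h y (hN n hn y hy x hxn)⟩

/-- Balls with small radius do not meet both a compact set and a closed set disjoint from it. -/
theorem exists_not_nonempty_inter {K F : Set X} (hK : IsCompact K) (hF : IsClosed F)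
    (hd : K ∩ F = ∅) : ∃ N : ℕ, ∀ n : ℕ × ℕ, N ≤ n.2 →
      (P.cball n ∩ K).Nonempty → ¬ (P.cball n ∩ F).Nonempty := by
  let := P.metricSpace
  obtain ⟨δ, hδ, h⟩ := hK.exists_thickening_subset_open hF.isOpen_compl
    (fun x hx hxF => (hd.subset ⟨hx, hxF⟩).elim)
  obtain ⟨N, hN⟩ := P.dist_lt_of_mem_cball hδ
  refine ⟨N, ?_⟩
  rintro n hn ⟨x, hxn, hxK⟩ ⟨y, hyn, hyF⟩
  exact h (Metric.mem_thickening_iff.2 ⟨x, hxK, hN n hn y hyn x hxn⟩) hyF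

theorem prec.cball_subset {P : Presentation X} {n m : ℕ × ℕ} (h : P.prec n m) :
    P.cball m ⊆ P.cball n := h.2.trans (P.ball_subset_cball n)

/-- The balls of a `P`-compatible sequence have a common point. -/
theorem exists_mem_cball_of_prec {f : ℕ → ℕ × ℕ} (hf : ∀ i, P.prec (f i) (f (i + 1))) :
    (∀ i, i ≤ (f i).2) ∧ ∃ x, ∀ i, x ∈ P.cball (f i) := by
  have hle (i : ℕ) : i ≤ (f i).2 := by
    induction i with
    | zero => exact Nat.zero_le _
    | succ i ih => exact ih.trans_lt (hf i).1
  have hanti : Antitone fun i => P.cball (f i) := antitone_nat_of_succ_le fun i =>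
    (hf i).cball_subset
  have hmem {i j : ℕ} (hij : i ≤ j) : P.seq (f j).1 ∈ P.cball (f i) :=
    hanti hij (P.ball_subset_cball _ (P.seq_mem_ball _))
  obtain ⟨x, hx⟩ := P.complete (fun i => P.seq (f i).1) fun ε hε => by
    obtain ⟨N, hN⟩ := P.dist_lt_of_mem_cball hε
    exact ⟨N, fun m hm n hn => hN (f N) (hle N) _ (hmem hm) _ (hmem hn)⟩
  refine ⟨hle, x, fun i => ?_⟩
  by_contra hxi
  obtain ⟨ε, hε, h⟩ := (P.isOpen_iff _).1 (P.isClosed_cball (f i)).isOpen_compl x hxi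
  obtain ⟨N, hN⟩ := hx ε hε
  exact h _ (hN (max N i) (le_max_left ..)) (hmem (le_max_right ..))

variable (A : Set (ℕ × ℕ))

theorem derivIter_zero : P.derivIter A 0 = A := by simp [derivIter]

theorem derivIter_add_one (o : Ordinal.{0}) :
    P.derivIter A (o + 1) = P.deriv (P.derivIter A o) := by simp [derivIter]

theorem derivIter_limit {o : Ordinal.{0}} (ho : Order.IsSuccLimit o) :
    P.derivIter A o = ⋂ β : {β : Ordinal.{0} // β < o}, P.derivIter A β.1 := by
  rw [derivIter, Ordinal.limitRecOn_limit _ _ _ _ ho]; rfl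

theorem derivIter_antitone : Antitone (P.derivIter A) :=
  antitone_of_iInter_limit (fun o => by rw [derivIter_add_one]; exact sep_subset _ _)
    fun _ => P.derivIter_limit A

variable {A}

theorem rankA_le {o : Ordinal.{0}} (h : P.derivIter A o = ∅) : P.rankA A ≤ o := by
  refine csInf_le' ?_
  have := P.derivIter_antitone A (Order.le_succ o)
  rw [h] at this
  exact (subset_eq_empty this rfl).trans h.symm

/-- The nodes all of whose compact traces on the `K_σ`-iterates are empty. -/
def IsBad (n : ℕ × ℕ) : Prop :=
  ∀ μ, IsCompact (P.cball n ∩ kIter X μ) → P.cball n ∩ kIter X μ = ∅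

/-- Reverse refinement between bad nodes. -/
def badRel (m n : ℕ × ℕ) : Prop := P.prec n m ∧ P.IsBad n ∧ P.IsBad m

theorem wellFounded_badRel {κ : Ordinal.{0}} (hκ : kIter X κ = ∅) :
    WellFounded P.badRel := by
  rw [wellFounded_iff_isEmpty_descending_chain]
  refine ⟨fun ⟨f, hf⟩ => ?_⟩
  obtain ⟨hle, x, hx⟩ := P.exists_mem_cball_of_prec fun i => (hf i).1
  obtain ⟨μ, -, hxμ, U, hU, hxU, hc⟩ := exists_isCompact_of_notMem_kIter
    (x := x) (o := κ) (by simp [hκ])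
  obtain ⟨N, hN⟩ := P.exists_cball_subset hU hxU
  have hcomp : IsCompact (P.cball (f N) ∩ kIter X μ) := by
    refine hc.of_isClosed_subset ((P.isClosed_cball _).inter (isClosed_kIter μ)) ?_
    rintro y ⟨hy, hyμ⟩
    exact ⟨hyμ, subset_closure ⟨hN _ (hle N) (hx N) hy, hyμ⟩⟩
  exact ((hf N).2.1 μ hcomp).subset ⟨hx N, hxμ⟩

/-- A well-founded relation on `ℕ × ℕ` has countable rank. -/
theorem exists_countable_rank {r : ℕ × ℕ → ℕ × ℕ → Prop} (hr : WellFounded r) :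
    ∃ (α : Ordinal.{0}) (ρ : ℕ × ℕ → Ordinal.{0}), α.card ≤ Cardinal.aleph0 ∧
      (∀ n, ρ n < α) ∧ ∀ m n, r m n → ρ m < ρ n := by
  have : IsWellFounded _ r := ⟨hr⟩
  refine ⟨⨆ n, (IsWellFounded.rank r n + 1), IsWellFounded.rank r, ?_, fun n => ?_,
    fun m n => IsWellFounded.rank_lt_of_rel⟩
  · have hsub : Iio (⨆ n, (IsWellFounded.rank r n + 1)) ⊆ range (IsWellFounded.rank r) := by
      intro o ho
      obtain ⟨n, hn⟩ := (Ordinal.lt_iSup_iff).1 ho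
      exact IsWellFounded.mem_range_rank_of_le (Order.lt_add_one_iff.1 hn)
    have hcard := Cardinal.mk_le_aleph0_iff.2 ((countable_range _).mono hsub).to_subtype
    rwa [Cardinal.mk_Iio_ordinal, Cardinal.lift_le_aleph0] at hcard
  · exact (Order.lt_add_one_iff.2 le_rfl).trans_le (Ordinal.le_iSup _ n)

end Presentation

open Ordinal in
/-- `α + ω·(1 + ρ) ≤ ω·ρ + α·ω` for infinite `α`. -/
theorem Ordinal.add_omega0_mul_le {α : Ordinal.{0}} (hα : ω ≤ α) (ρ : Ordinal.{0}) :
    α + ω * (1 + ρ) ≤ ω * ρ + α * ω := by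
  rw [mul_add, mul_one]
  rcases le_or_gt (α * ω) (ω * ρ) with h | h
  · have habs : α + (ω + α * ω) ≤ α * ω := calc
      α + (ω + α * ω) ≤ α + (α + α * ω) := by gcongr
      _ = α * (1 + (1 + ω)) := by simp only [mul_add, mul_one]
      _ = α * ω := by rw [one_add_omega0, one_add_omega0]
    obtain ⟨s, hs⟩ := exists_add_of_le h
    rw [hs]
    calc α + (ω + (α * ω + s)) = α + (ω + α * ω) + s := by simp only [add_assoc]
      _ ≤ α * ω + s := by gcongr
      _ ≤ _ := le_self_add
  · obtain ⟨c, hc, hlt⟩ := (lt_mul_iff_of_isSuccLimit isSuccLimit_omega0).1 h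
    obtain ⟨k, rfl⟩ := lt_omega0.1 hc
    calc α + (ω + ω * ρ) ≤ α + (α + α * k) := by gcongr
      _ = α * (1 + (1 + k)) := by simp only [mul_add, mul_one]
      _ ≤ α * ω := by
        gcongr
        exact_mod_cast (natCast_lt_omega0 (1 + (1 + k))).le
      _ ≤ _ := le_add_self

namespace Presentation

variable {X : Type} [TopologicalSpace X] (P : Presentation X) {A : Set (ℕ × ℕ)}

/-- A node surviving `k` further derivatives has a refinement of size at most `2^{-k}`. -/
theorem exists_le_snd_of_mem_derivIter {τ : Ordinal.{0}} (k : ℕ) {n : ℕ × ℕ}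
    (hn : n ∈ P.derivIter A (τ + k)) :
    ∃ m ∈ P.derivIter A τ, k ≤ m.2 ∧ P.cball m ⊆ P.cball n := by
  suffices H : ∃ m ∈ P.derivIter A τ, n.2 + k ≤ m.2 ∧ P.cball m ⊆ P.cball n by
    obtain ⟨m, hm, hk, hs⟩ := H
    exact ⟨m, hm, by omega, hs⟩
  induction k generalizing n with
  | zero => exact ⟨n, by simpa using hn, by simp, subset_rfl⟩
  | succ k ih =>
    rw [Nat.cast_succ, ← add_assoc, derivIter_add_one] at hn
    obtain ⟨-, u, hu, -, -, hnu, -⟩ := hn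
    obtain ⟨m, hm, hk, hs⟩ := ih hu
    exact ⟨m, hm, by have := hnu.1; omega, hs.trans hnu.cball_subset⟩

/-- If every ball avoiding `E` is removed at stage `τ`, then every ball meeting `E` in at most `k`
points is removed at stage `τ + k`. -/
theorem notMem_derivIter_of_encard_le {E : Set X} {τ : Ordinal.{0}} {n₀ : ℕ × ℕ}
    (h : ∀ n, P.cball n ⊆ P.cball n₀ → P.cball n ∩ E = ∅ → n ∉ P.derivIter A τ) (k : ℕ) :
    ∀ n, P.cball n ⊆ P.cball n₀ → (P.cball n ∩ E).encard ≤ k →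
      n ∉ P.derivIter A (τ + k) := by
  induction k with
  | zero =>
    intro n hn hk
    simpa using h n hn (by simpa using hk)
  | succ k ih =>
    intro n hn hk hmem
    rw [Nat.cast_succ, ← add_assoc, derivIter_add_one] at hmem
    obtain ⟨-, u, hu, v, hv, hnu, hnv, huv⟩ := hmem
    have hcard {w : ℕ × ℕ} (hw : w ∈ P.derivIter A (τ + k)) (hnw : P.prec n w) :
        ((k + 1 : ℕ) : ℕ∞) ≤ (P.cball w ∩ E).encard := by
      by_contra hlt
      refine ih w (hnw.cball_subset.trans hn) ?_ hw
      exact Order.le_of_lt_add_one (by simpa using hlt)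
    have hdisj : Disjoint (P.cball u ∩ E) (P.cball v ∩ E) :=
      (disjoint_iff_inter_eq_empty.2 huv).mono inter_subset_left inter_subset_left
    have hle : (P.cball u ∩ E ∪ P.cball v ∩ E).encard ≤ (k + 1 : ℕ) :=
      (encard_le_encard (union_subset (inter_subset_inter_left _ hnu.cball_subset)
        (inter_subset_inter_left _ hnv.cball_subset))).trans hk
    rw [encard_union_eq hdisj] at hle
    have h2 := (add_le_add (hcard hu hnu) (hcard hv hnv)).trans hle
    norm_cast at h2
    omega

/-- The analysis of nodes with compact trace on a closed set `Y`, provided that all the balls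
surviving at stage `τ` meet `Y`. -/
theorem notMem_derivIter_of_isCompact [T1Space X] {F Y : Set X} (hF : IsClosed F) {τ : Ordinal.{0}}
    (hY : ∀ n ∈ P.derivIter (P.code F) τ, (P.cball n ∩ Y).Nonempty) (hYc : IsClosed Y)
    (β : Ordinal.{0}) :
    ∀ n, IsCompact (P.cball n ∩ Y) → P.cball n ∩ (Y ∩ cbIter F β) = ∅ →
      n ∉ P.derivIter (P.code F) (τ + Ordinal.omega0 * (1 + β)) := by
  induction β using Ordinal.limitRecOn with
  | zero =>
    intro n hc he hn
    rw [cbIter_zero, ← inter_assoc] at he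
    obtain ⟨N, hN⟩ := P.exists_not_nonempty_inter hc hF he
    obtain ⟨m, hm, hNm, hmn⟩ := P.exists_le_snd_of_mem_derivIter N
      (P.derivIter_antitone _ (add_le_add_right (a := τ) (c := Ordinal.omega0 * (1 + 0))
        (by simpa using (Ordinal.natCast_lt_omega0 N).le)) hn)
    obtain ⟨y, hym, hyY⟩ := hY m hm
    have hcode : m ∈ P.code F := by
      have := P.derivIter_antitone (P.code F) (zero_le (a := τ)) hm
      rwa [derivIter_zero] at this
    obtain ⟨z, hzm, hzF⟩ := hcode
    exact hN m hNm ⟨y, hym, hmn hym, hyY⟩ ⟨z, P.ball_subset_cball _ hzm, hzF⟩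
  | add_one β ih =>
    intro n hc he hn
    have hfin : (P.cball n ∩ (Y ∩ cbIter F β)).Finite := by
      by_contra hinf
      obtain ⟨x, hx, hacc⟩ := Set.Infinite.exists_accPt_of_subset_isCompact hinf hc
        (inter_subset_inter_right _ inter_subset_left)
      have hacc' : AccPt x (𝓟 (cbIter F β)) :=
        hacc.mono (principal_mono.2 fun z hz => hz.2.2)
      have hxF : x ∈ cbIter F β := (isClosed_iff_derivedSet_subset _).1
        (isClosed_cbIter hF β) hacc'
      refine (he.subset ⟨hx.1, hx.2, ?_⟩).elim
      rw [cbIter_add_one]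
      exact ⟨hxF, hacc'⟩
    refine P.notMem_derivIter_of_encard_le (n₀ := n) (fun m hmn hm => ih m ?_ hm)
      (P.cball n ∩ (Y ∩ cbIter F β)).ncard n subset_rfl hfin.cast_ncard_eq.ge
      (P.derivIter_antitone _ ?_ hn)
    · exact hc.of_isClosed_subset ((P.isClosed_cball m).inter hYc) (inter_subset_inter_left _ hmn)
    · rw [← add_assoc 1 β 1, mul_add_one, ← add_assoc]
      gcongr
      exact (Ordinal.natCast_lt_omega0 _).le
  | limit β hβ ih =>
    intro n hc he hn
    have : Nonempty {γ : Ordinal.{0} // γ < β} := ⟨⟨0, hβ.bot_lt⟩⟩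
    obtain ⟨γ, hγ⟩ := hc.elim_directed_family_closed
      (fun γ : {γ : Ordinal.{0} // γ < β} => cbIter F γ.1) (fun γ => isClosed_cbIter hF _)
      (by rw [← cbIter_limit F hβ, inter_assoc, he])
      ((cbIter_antitone F).comp_monotone (Subtype.mono_coe _)).directed_ge
    refine ih γ.1 γ.2 n hc (by rw [← inter_assoc, hγ]) (P.derivIter_antitone _ ?_ hn)
    gcongr
    exact γ.2.le

/-- The rank estimate, with the constant governed by any countable bound on the ranks of bad
nodes. -/
theorem notMem_derivIter_of_inter_kIter_eq_empty [PolishSpace X] {F : Set X} (hF : IsClosed F)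
    (hFc : F.Countable) {α : Ordinal.{0}} (hα : Ordinal.omega0 ≤ α) {ρ : ℕ × ℕ → Ordinal.{0}}
    (hρ : ∀ n, ρ n < α) (hbad : ∀ m n, P.badRel m n → ρ m < ρ n) (γ : Ordinal.{0}) :
    ∀ n, P.cball n ∩ kIter X γ = ∅ → n ∉ P.derivIter (P.code F)
      ((Ordinal.omega0 * cbRank F + α * Ordinal.omega0) * γ + α) := by
  set Θ := Ordinal.omega0 * cbRank F + α * Ordinal.omega0
  induction γ using WellFoundedLT.induction with
  | ind γ ih =>
  have hgood (n : ℕ × ℕ) (hn : P.cball n ∩ kIter X γ = ∅) (hg : ¬ P.IsBad n) :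
      n ∉ P.derivIter (P.code F) (Θ * γ) := by
    intro hmem
    simp only [IsBad, not_forall] at hg
    obtain ⟨μ, hμ, hne⟩ := hg
    have hμγ : μ < γ := by
      by_contra! hle
      exact hne (subset_eq_empty (inter_subset_inter_right _ (kIter_antitone hle)) hn)
    refine P.notMem_derivIter_of_isCompact hF (τ := Θ * μ + α)
      (fun m hm => nonempty_iff_ne_empty.2 fun h => ih μ hμγ m h hm) (isClosed_kIter μ)
      (cbRank F) n hμ (by simp [cbIter_cbRank_eq_empty hF hFc])
      (P.derivIter_antitone _ ?_ hmem)
    calc Θ * μ + α + Ordinal.omega0 * (1 + cbRank F)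
        = Θ * μ + (α + Ordinal.omega0 * (1 + cbRank F)) := add_assoc ..
      _ ≤ Θ * μ + Θ := by gcongr; exact Ordinal.add_omega0_mul_le hα _
      _ = Θ * (μ + 1) := (mul_add_one ..).symm
      _ ≤ Θ * γ := by gcongr; exact Order.add_one_le_of_lt hμγ
  have hrank (o : Ordinal.{0}) : ∀ n, ρ n = o → P.cball n ∩ kIter X γ = ∅ →
      n ∉ P.derivIter (P.code F) (Θ * γ + (o + 1)) := by
    induction o using WellFoundedLT.induction with
    | ind o iho =>
    intro n hno hn hmem
    have hmem' := hmem
    rw [← add_assoc, derivIter_add_one] at hmem'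
    obtain ⟨-, u, hu, -, -, hnu, -⟩ := hmem'
    have hue : P.cball u ∩ kIter X γ = ∅ :=
      subset_eq_empty (inter_subset_inter_left _ hnu.cball_subset) hn
    by_cases hbn : P.IsBad n
    · by_cases hbu : P.IsBad u
      · have hlt : ρ u < o := hno ▸ hbad u n ⟨hnu, hbn, hbu⟩
        refine iho _ hlt u rfl hue (P.derivIter_antitone _ ?_ hu)
        gcongr
        exact Order.add_one_le_of_lt hlt
      · exact hgood u hue hbu (P.derivIter_antitone _ le_self_add hu)
    · exact hgood n hn hbn (P.derivIter_antitone _ le_self_add hmem)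
  intro n hn hmem
  refine hrank _ n rfl hn (P.derivIter_antitone _ ?_ hmem)
  gcongr
  exact Order.add_one_le_of_lt (hρ n)

end Presentation

/-- For a σ-compact Polish space `X` and any presentation `P`, there are
countable ordinals `α_P, β_P` such that `φ_P(F) ≤ (ω·|F|_CB + α_P)·|X|_{K_σ} + β_P` for
every countable closed `F ⊆ X`. -/
theorem stmt2 {X : Type} [TopologicalSpace X] [PolishSpace X] [SigmaCompactSpace X]
    (P : Presentation X) :
    ∃ αP βP : Ordinal.{0}, αP.card ≤ Cardinal.aleph0 ∧ βP.card ≤ Cardinal.aleph0 ∧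
      ∀ F : Set X, IsClosed F → F.Countable →
        P.phi F ≤ (Ordinal.omega0 * cbRank F + αP) * kRank X + βP := by
  obtain ⟨α, ρ, hα, hρ, hbad⟩ :=
    Presentation.exists_countable_rank (P.wellFounded_badRel kIter_kRank_eq_empty)
  have hcard : (Ordinal.omega0 + α).card ≤ Cardinal.aleph0 := by
    rw [Ordinal.card_add, Ordinal.card_omega0]
    exact Cardinal.add_le_aleph0.2 ⟨le_rfl, hα⟩
  refine ⟨(Ordinal.omega0 + α) * Ordinal.omega0, Ordinal.omega0 + α, ?_, hcard,
    fun F hF hFc => P.rankA_le (eq_empty_of_forall_notMem fun n => ?_)⟩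
  · rw [Ordinal.card_mul, Ordinal.card_omega0]
    exact (mul_le_mul_left hcard _).trans_eq Cardinal.aleph0_mul_aleph0
  · exact P.notMem_derivIter_of_inter_kIter_eq_empty hF hFc le_self_add
      (fun n => (hρ n).trans_le le_add_self) hbad _ n (by simp [kIter_kRank_eq_empty])
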